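/- arXiv:2202.08068 — 2 statements merged into one kernel-verified Lean document; each statement's English description precedes it below -/
import Mathlib

section
/- Let G = (V, E) be a connected graph with augmentation Ĝ = (V, E ∪ F), and let e ∈ E. The inequality 0 ≤ x_e defines a facet of LMC(G, Ĝ) if and only if no triangle in Ĝ contains e. -/
open Finset

open scoped Classical

variable {V : Type*}

/-- A decomposition of a graph `G`: a partition of the node set all of whose blocks
induce connected subgraphs. -/
def IsDecomposition (G : SimpleGraph V) (P : Set (Set V)) : Prop :=
  Setoid.IsPartition P ∧ ∀ U ∈ P, (G.induce U).Connected

/-- Two nodes lie in a common block of `P`. -/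
def SameBlock (P : Set (Set V)) (u v : V) : Prop :=
  ∃ U ∈ P, u ∈ U ∧ v ∈ U

/-- The edge `e` straddles two distinct blocks of `P`. -/
def Crosses (P : Set (Set V)) (e : Sym2 V) : Prop :=
  ∃ u v, e = s(u, v) ∧ ¬ SameBlock P u v

/-- The multicut of `G` induced by a decomposition `P`. -/
def inducedMulticut (G : SimpleGraph V) (P : Set (Set V)) : Set (Sym2 V) :=
  {e | e ∈ G.edgeSet ∧ Crosses P e}

/-- `M` is a multicut of `G`. -/
def IsMulticut (G : SimpleGraph V) (M : Set (Sym2 V)) : Prop :=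
  ∃ P, IsDecomposition G P ∧ M = inducedMulticut G P

/-- The characteristic vector (in the ambient space `Sym2 V → ℝ`, with coordinates
outside the edge set of `H` pinned to `0`) of the multicut of `H` induced by `P`. -/
noncomputable def multicutVec (H : SimpleGraph V) (P : Set (Set V)) : Sym2 V → ℝ :=
  fun e => if e ∈ H.edgeSet ∧ Crosses P e then 1 else 0

/-- Characteristic vectors of multicuts of `H` lifted from `G`. -/
def liftedVectors (G H : SimpleGraph V) : Set (Sym2 V → ℝ) :=
  {x | ∃ P, IsDecomposition G P ∧ x = multicutVec H P}

/-- The lifted multicut polytope with respect to `G` and `H`. -/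
def LMC (G H : SimpleGraph V) : Set (Sym2 V → ℝ) :=
  convexHull ℝ (liftedVectors G H)

/-- The inequality `f x ≤ b` is valid for `P` and its equality set has affine dimension
`|E ∪ F| - 1`, i.e. one less than the dimension of the corresponding lifted multicut
polytope for the augmented graph `H`. -/
def DefinesFacet (H : SimpleGraph V) (P : Set (Sym2 V → ℝ))
    (f : (Sym2 V → ℝ) → ℝ) (b : ℝ) : Prop :=
  (∀ x ∈ P, f x ≤ b) ∧
  Module.finrank ℝ (affineSpan ℝ {x | x ∈ P ∧ f x = b}).direction + 1 = Nat.card H.edgeSet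

lemma crosses_mk_iff (P : Set (Set V)) (a b : V) : Crosses P s(a, b) ↔ ¬ SameBlock P a b := by
  constructor
  · rintro ⟨c, d, h, hcd⟩ ⟨U, hU, ha, hb⟩
    rcases Sym2.eq_iff.1 h with ⟨rfl, rfl⟩ | ⟨rfl, rfl⟩
    · exact hcd ⟨U, hU, ha, hb⟩
    · exact hcd ⟨U, hU, hb, ha⟩
  · exact fun h => ⟨a, b, rfl, h⟩

lemma SameBlock.trans {P : Set (Set V)} (hP : Setoid.IsPartition P) {a b c : V}
    (hab : SameBlock P a b) (hbc : SameBlock P b c) : SameBlock P a c := by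
  obtain ⟨U, hU, ha, hb⟩ := hab
  obtain ⟨W, hW, hb', hc⟩ := hbc
  obtain rfl := (hP.2 b).unique ⟨hU, hb⟩ ⟨hW, hb'⟩
  exact ⟨U, hU, ha, hc⟩

section Polytope

variable {G H : SimpleGraph V}

lemma nonneg_of_mem_LMC {x : Sym2 V → ℝ} (hx : x ∈ LMC G H) (e : Sym2 V) : 0 ≤ x e := by
  have hc : Convex ℝ {x : Sym2 V → ℝ | 0 ≤ x e} :=
    convex_halfSpace_ge (LinearMap.proj (R := ℝ) (φ := fun _ : Sym2 V => ℝ) e).isLinear 0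
  refine convexHull_min ?_ hc hx
  rintro _ ⟨P, -, rfl⟩
  change 0 ≤ multicutVec H P e
  unfold multicutVec
  split_ifs <;> simp

lemma eq_zero_of_mem_LMC {x : Sym2 V → ℝ} (hx : x ∈ LMC G H) {e : Sym2 V}
    (he : e ∉ H.edgeSet) : x e = 0 := by
  have hc : Convex ℝ {x : Sym2 V → ℝ | x e = 0} :=
    convex_hyperplane (LinearMap.proj (R := ℝ) (φ := fun _ : Sym2 V => ℝ) e).isLinear 0
  refine convexHull_min ?_ hc hx
  rintro _ ⟨P, -, rfl⟩
  change multicutVec H P e = 0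
  simp [multicutVec, he]

lemma triangle_inequality_of_mem_LMC {x : Sym2 V → ℝ} (hx : x ∈ LMC G H) {a b c : V}
    (hab : H.Adj a b) (hbc : H.Adj b c) : x s(a, c) ≤ x s(a, b) + x s(b, c) := by
  have hc : Convex ℝ {x : Sym2 V → ℝ | x s(a, c) - x s(a, b) - x s(b, c) ≤ 0} := by
    let proj (e : Sym2 V) := LinearMap.proj (R := ℝ) (φ := fun _ : Sym2 V => ℝ) e
    exact convex_halfSpace_le (proj s(a, c) - proj s(a, b) - proj s(b, c)).isLinear 0
  have key : x ∈ {x : Sym2 V → ℝ | x s(a, c) - x s(a, b) - x s(b, c) ≤ 0} := by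
    refine convexHull_min ?_ hc hx
    rintro _ ⟨P, hP, rfl⟩
    change multicutVec H P s(a, c) - multicutVec H P s(a, b) - multicutVec H P s(b, c) ≤ 0
    have := SameBlock.trans hP.1 (a := a) (b := b) (c := c)
    simp only [multicutVec, crosses_mk_iff, SimpleGraph.mem_edgeSet, hab, hbc, true_and]
    split_ifs <;> first | (exfalso; tauto) | norm_num
  have key' : x s(a, c) - x s(a, b) - x s(b, c) ≤ 0 := key
  linarith

end Polytope

section Coarsening

variable {X : Type*} {G : SimpleGraph V} {π : V → X}

/-- The equivalence relation whose classes are the fibres of `π`, except that all fibres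
over `T` are merged. -/
def mergedFibres (π : V → X) (T : Set X) : Setoid V where
  r a b := π a = π b ∨ π a ∈ T ∧ π b ∈ T
  iseqv :=
    { refl := fun _ => Or.inl rfl
      symm := by
        rintro a b (h | h)
        exacts [Or.inl h.symm, Or.inr h.symm]
      trans := by
        rintro a b c (h | h) (h' | h')
        exacts [Or.inl (h.trans h'), Or.inr (h ▸ h'), Or.inr (h' ▸ h), Or.inr ⟨h.1, h'.2⟩] }

lemma mergedFibres_rel {T : Set X} {a b : V} :
    mergedFibres π T a b ↔ π a = π b ∨ π a ∈ T ∧ π b ∈ T := Iff.rfl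

lemma crosses_mergedFibres_iff {T : Set X} {a b : V} :
    Crosses (mergedFibres π T).classes s(a, b) ↔ π a ≠ π b ∧ ¬ (π a ∈ T ∧ π b ∈ T) := by
  rw [crosses_mk_iff, SameBlock, ← Setoid.rel_iff_exists_classes, mergedFibres_rel, not_or]

lemma isDecomposition_mergedFibres (hπ : ∀ x, (G.induce (π ⁻¹' {x})).Preconnected)
    {T : Set X} (hT : (G.induce (π ⁻¹' T)).Preconnected) :
    IsDecomposition G (mergedFibres π T).classes := by
  refine ⟨Setoid.isPartition_classes _, ?_⟩
  rintro _ ⟨b, rfl⟩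
  have hne : Nonempty {a | mergedFibres π T a b} := ⟨⟨b, Or.inl rfl⟩⟩
  refine @SimpleGraph.Connected.mk _ _ ?_ hne
  by_cases hb : π b ∈ T
  · convert hT using 2
    all_goals
      ext a
      simp only [Set.mem_preimage]
      exact ⟨fun h => h.elim (fun h => h ▸ hb) And.left, fun h => Or.inr ⟨h, hb⟩⟩
  · convert hπ (π b) using 2
    all_goals
      ext a
      exact ⟨fun h => h.elim id fun h => absurd h.2 hb, Or.inl⟩

lemma preconnected_preimage_union {S T : Set X}
    (hS : (G.induce (π ⁻¹' S)).Preconnected) (hT : (G.induce (π ⁻¹' T)).Preconnected)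
    {x y : X} (hx : x ∈ S) (hy : y ∈ T) (h : (G.map π).Adj x y) :
    (G.induce (π ⁻¹' (S ∪ T))).Preconnected := by
  obtain ⟨-, a, b, hab, rfl, rfl⟩ := h
  exact (SimpleGraph.connected_induce_union hS hT hx hy hab).preconnected

lemma preconnected_preimage_support (hπ : ∀ x, (G.induce (π ⁻¹' {x})).Preconnected)
    {x y : X} (p : (G.map π).Walk x y) :
    (G.induce (π ⁻¹' {z | z ∈ p.support})).Preconnected := by
  induction p with
  | @nil x =>
    convert hπ x using 3
    all_goals simp
  | @cons x y z h p ih =>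
    have : {w | w ∈ (SimpleGraph.Walk.cons h p).support} = {x} ∪ {w | w ∈ p.support} := by
      ext; simp
    rw [this]
    exact preconnected_preimage_union (hπ x) ih rfl p.start_mem_support h

/-- Two nodes of a contraction can be joined through a set of nodes so that connectivity is
preserved when either end, or both, are removed. -/
lemma exists_preconnected_preimages (hG : G.Preconnected)
    (hπ : ∀ x, (G.induce (π ⁻¹' {x})).Preconnected) {a b : V} (hab : π a ≠ π b) :
    ∃ R : Set X, π a ∉ R ∧ π b ∉ R ∧
      (G.induce (π ⁻¹' R)).Preconnected ∧
      (G.induce (π ⁻¹' ({π a} ∪ R))).Preconnected ∧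
      (G.induce (π ⁻¹' ({π b} ∪ R))).Preconnected ∧
      (G.induce (π ⁻¹' ({π a} ∪ ({π b} ∪ R)))).Preconnected := by
  have hreach : ∀ {c d : V}, G.Walk c d → (G.map π).Reachable (π c) (π d) := by
    intro c d p
    induction p with
    | nil => rfl
    | @cons c d e h p ih =>
      by_cases hcd : π c = π d
      · rwa [hcd]
      · exact SimpleGraph.Reachable.trans
          (SimpleGraph.Adj.reachable ⟨hcd, c, d, h, rfl, rfl⟩) ih
  obtain ⟨p, hp⟩ := (hreach (hG a b).some).exists_isPath
  generalize π a = x at *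
  generalize π b = y at *
  cases p with
  | nil => exact absurd rfl hab
  | @cons _ z _ h q =>
    rw [SimpleGraph.Walk.cons_isPath_iff] at hp
    obtain ⟨hq, hxq⟩ := hp
    have hq' := hq.reverse
    have hxq' : x ∉ q.reverse.support := by simpa using hxq
    generalize q.reverse = r at hq' hxq'
    cases r with
    | nil =>
      refine ⟨∅, by simp, by simp, ?_, ?_, ?_, ?_⟩
      · rintro ⟨c, hc⟩
        exact absurd hc (by simp)
      · rw [Set.union_empty]
        exact hπ x
      · rw [Set.union_empty]
        exact hπ y
      · rw [Set.union_empty]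
        exact preconnected_preimage_union (hπ x) (hπ y) rfl rfl h
    | @cons _ w _ h' r =>
      rw [SimpleGraph.Walk.cons_isPath_iff] at hq'
      have hz : z ∈ {c | c ∈ r.support} := r.end_mem_support
      have hw : w ∈ {c | c ∈ r.support} := r.start_mem_support
      have hR := preconnected_preimage_support hπ r
      have hyR := preconnected_preimage_union (hπ y) hR rfl hw h'
      exact ⟨{c | c ∈ r.support}, fun hx => hxq' (List.mem_cons_of_mem _ hx), hq'.2, hR,
        preconnected_preimage_union (hπ x) hR rfl hz h, hyR,
        preconnected_preimage_union (hπ x) hyR rfl (Or.inr hz) h⟩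

lemma multicutVec_mergedFibres_alternating_sum (H : SimpleGraph V) {R : Set X} {a b c d : V}
    (hab : π a ≠ π b) (ha : π a ∉ R) (hb : π b ∉ R) :
    (multicutVec H (mergedFibres π ({π a} ∪ R)).classes s(c, d)
        - multicutVec H (mergedFibres π R).classes s(c, d))
      + (multicutVec H (mergedFibres π ({π b} ∪ R)).classes s(c, d)
        - multicutVec H (mergedFibres π ({π a} ∪ ({π b} ∪ R))).classes s(c, d))
      = if H.Adj c d ∧ (π c = π a ∧ π d = π b ∨ π c = π b ∧ π d = π a) then 1 else 0 := by
  simp only [multicutVec, crosses_mergedFibres_iff, SimpleGraph.mem_edgeSet, Set.mem_union,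
    Set.mem_singleton_iff]
  by_cases hcd : H.Adj c d
  swap
  · simp [hcd]
  generalize π a = x at *
  generalize π b = y at *
  generalize π c = z at *
  generalize π d = w at *
  by_cases hzw : z = w
  · subst hzw
    have : ¬ (z = x ∧ z = y ∨ z = y ∧ z = x) := by grind
    simp [this]
  by_cases h1 : z = x <;> by_cases h2 : w = x <;> by_cases h3 : z = y <;> by_cases h4 : w = y <;>
    by_cases h5 : z ∈ R <;> by_cases h6 : w ∈ R <;> simp_all

end Coarsening

section Span

/-- The vectors of `ℝ^ι` supported on `A`. -/
noncomputable def coordinateSubspace {ι : Type*} [DecidableEq ι] (A : Set ι) : Submodule ℝ (ι → ℝ) :=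
  Submodule.span ℝ (Set.range fun i : A => (Pi.single (i : ι) 1 : ι → ℝ))

variable {ι : Type*} [Finite ι] [DecidableEq ι]

lemma mem_coordinateSubspace {A : Set ι} {x : ι → ℝ} (hx : ∀ i ∉ A, x i = 0) :
    x ∈ coordinateSubspace A := by
  cases nonempty_fintype ι
  rw [pi_eq_sum_univ' x]
  refine Submodule.sum_mem _ fun i _ => ?_
  by_cases hi : i ∈ A
  · refine Submodule.smul_mem _ _ (Submodule.subset_span ⟨⟨i, hi⟩, ?_⟩)
    ext j
    simp [Pi.single_apply, eq_comm]
  · simp [hx i hi]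

lemma finrank_coordinateSubspace (A : Set ι) :
    Module.finrank ℝ (coordinateSubspace A) = Nat.card A := by
  cases nonempty_fintype ι
  have h : LinearIndependent ℝ fun i : A => (Pi.single (i : ι) 1 : ι → ℝ) := by
    convert (Pi.basisFun ℝ ι).linearIndependent.comp _ (Subtype.val_injective (p := (· ∈ A)))
      using 1
    ext i j
    simp
  rw [coordinateSubspace, finrank_span_eq_card h, Nat.card_eq_fintype_card]

end Span

section Face

variable {G H : SimpleGraph V} {e : Sym2 V}

lemma vectorSpan_face_le [Finite V] :
    vectorSpan ℝ {x | x ∈ LMC G H ∧ - x e = 0} ≤ coordinateSubspace (H.edgeSet \ {e}) := by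
  rw [vectorSpan_def, Submodule.span_le]
  rintro _ ⟨x, ⟨hx, hxe⟩, y, ⟨hy, hye⟩, rfl⟩
  refine mem_coordinateSubspace fun i hi => ?_
  by_cases hie : i = e
  · subst hie
    simp [neg_eq_zero.1 hxe, neg_eq_zero.1 hye]
  · have hi' : i ∉ H.edgeSet := fun h => hi ⟨h, hie⟩
    simp [eq_zero_of_mem_LMC hx hi', eq_zero_of_mem_LMC hy hi']

lemma definesFacet_iff_vectorSpan_face_eq [Finite V] (he : e ∈ H.edgeSet) :
    DefinesFacet H (LMC G H) (fun x => - x e) 0 ↔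
      vectorSpan ℝ {x | x ∈ LMC G H ∧ - x e = 0} = coordinateSubspace (H.edgeSet \ {e}) := by
  have hcard : Nat.card ↥(H.edgeSet \ {e}) + 1 = Nat.card H.edgeSet := by
    simpa only [Nat.card_coe_set_eq] using Set.ncard_sdiff_singleton_add_one he (Set.toFinite _)
  have hvalid : ∀ x ∈ LMC G H, - x e ≤ 0 := fun x hx => neg_nonpos.2 (nonneg_of_mem_LMC hx e)
  rw [DefinesFacet, direction_affineSpan, ← hcard, ← finrank_coordinateSubspace]
  constructor
  · exact fun h => Submodule.eq_of_le_of_finrank_eq vectorSpan_face_le (Nat.succ_injective h.2)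
  · exact fun h => ⟨hvalid, by rw [h]⟩

lemma vectorSpan_face_ne_of_triangle {u v w : V} (huv : H.Adj u v) (huw : H.Adj u w)
    (hvw : H.Adj v w) :
    vectorSpan ℝ {x | x ∈ LMC G H ∧ - x s(u, v) = 0} ≠
      coordinateSubspace (H.edgeSet \ {s(u, v)}) := by
  intro heq
  let proj (e : Sym2 V) := LinearMap.proj (R := ℝ) (φ := fun _ : Sym2 V => ℝ) e
  have hface : ∀ x ∈ {x | x ∈ LMC G H ∧ - x s(u, v) = 0}, x s(u, w) = x s(v, w) := by
    rintro x ⟨hx, hxe⟩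
    have h1 := triangle_inequality_of_mem_LMC hx huv hvw
    have h2 := triangle_inequality_of_mem_LMC hx huv.symm huw
    rw [Sym2.eq_swap (a := v) (b := u)] at h2
    linarith
  have hle : vectorSpan ℝ {x | x ∈ LMC G H ∧ - x s(u, v) = 0} ≤
      LinearMap.ker (proj s(u, w) - proj s(v, w)) := by
    rw [vectorSpan_def, Submodule.span_le]
    rintro _ ⟨x, hx, y, hy, rfl⟩
    simp [proj, hface x hx, hface y hy]
  have hmem : (Pi.single s(u, w) 1 : Sym2 V → ℝ) ∈
      coordinateSubspace (H.edgeSet \ {s(u, v)}) :=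
    Submodule.subset_span ⟨⟨s(u, w), huw, by simp [hvw.ne', huw.ne']⟩, rfl⟩
  have hzero := hle (heq ▸ hmem)
  have hne : s(v, w) ≠ s(u, w) := by simp [huv.ne', hvw.ne]
  simp [proj, hne] at hzero

/-- The map that identifies `v` with `u`. -/
noncomputable def identify (u v : V) : V → V := fun a => if a = v then u else a

lemma preconnected_fibre_identify {u v : V} (huv : G.Adj u v) (x : V) :
    (G.induce (identify u v ⁻¹' {x})).Preconnected := by
  by_cases hx : x = u
  · subst hx
    have : identify x v ⁻¹' {x} = {x, v} := by
      ext a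
      simp only [identify, Set.mem_preimage, Set.mem_singleton_iff, Set.mem_insert_iff]
      grind
    rw [this]
    exact (SimpleGraph.induce_pair_connected_of_adj huv).preconnected
  · rintro ⟨a, ha⟩ ⟨b, hb⟩
    have : a = b := by
      simp only [identify, Set.mem_preimage, Set.mem_singleton_iff] at ha hb
      grind
    subst this
    rfl

lemma coordinateSubspace_le_vectorSpan_face (hG : G.Connected) {u v : V} (huv : G.Adj u v)
    (htri : ¬ ∃ w : V, H.Adj u w ∧ H.Adj v w) :
    coordinateSubspace (H.edgeSet \ {s(u, v)}) ≤
      vectorSpan ℝ {x | x ∈ LMC G H ∧ - x s(u, v) = 0} := by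
  set π := identify u v with hπdef
  have hπ : ∀ x, (G.induce (π ⁻¹' {x})).Preconnected := preconnected_fibre_identify huv
  have hπuv : π u = π v := by simp [hπdef, identify]
  have hface : ∀ {T : Set V}, (G.induce (π ⁻¹' T)).Preconnected →
      multicutVec H (mergedFibres π T).classes ∈ {x | x ∈ LMC G H ∧ - x s(u, v) = 0} := by
    refine fun hT => ⟨subset_convexHull ℝ _ ⟨_, isDecomposition_mergedFibres hπ hT, rfl⟩, ?_⟩
    simp [multicutVec, crosses_mergedFibres_iff, hπuv]
  rw [coordinateSubspace, Submodule.span_le]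
  rintro _ ⟨⟨f, hf, hfe⟩, rfl⟩
  induction f using Sym2.ind with
  | _ a b =>
  rw [SimpleGraph.mem_edgeSet] at hf
  have hab : π a ≠ π b := by
    have := hf.ne
    simp only [Set.mem_singleton_iff, Sym2.eq_iff] at hfe
    simp only [hπdef, identify]
    grind
  obtain ⟨R, ha, hb, hR, haR, hbR, habR⟩ := exists_preconnected_preimages hG.preconnected hπ hab
  have hmem := add_mem (vsub_mem_vectorSpan ℝ (hface haR) (hface hR))
    (vsub_mem_vectorSpan ℝ (hface hbR) (hface habR))
  change (Pi.single s(a, b) 1 : Sym2 V → ℝ) ∈ vectorSpan ℝ _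
  convert hmem using 1
  funext g
  induction g using Sym2.ind with
  | _ c d =>
  refine Eq.trans ?_ (multicutVec_mergedFibres_alternating_sum H hab ha hb).symm
  have huniq : H.Adj c d ∧ (π c = π a ∧ π d = π b ∨ π c = π b ∧ π d = π a) ↔
      s(c, d) = s(a, b) := by
    rw [Sym2.eq_iff]
    have := hf.symm
    have hsymm := fun x y => H.adj_comm x y
    simp only [hπdef, identify] at hab ⊢
    grind
  simp only [Pi.single_apply, huniq]

end Face

/-- for an edge `e = s(u,v) ∈ E`, the inequality `0 ≤ x_e` defines a facet
of `LMC(G, Gh)` iff no triangle of `Gh` contains `e`. -/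
theorem lower_box_facet_iff
    {V : Type*} [Fintype V] (G Gh : SimpleGraph V)
    (hG : G.Connected) (hle : G ≤ Gh)
    (u v : V) (huv : G.Adj u v) :
    DefinesFacet Gh (LMC G Gh) (fun x => - x s(u, v)) 0 ↔
      ¬ ∃ w : V, Gh.Adj u w ∧ Gh.Adj v w := by
  rw [definesFacet_iff_vectorSpan_face_eq (hle huv)]
  constructor
  · rintro heq ⟨w, huw, hvw⟩
    exact vectorSpan_face_ne_of_triangle (hle huv) huw hvw heq
  · exact fun h => le_antisymm vectorSpan_face_le (coordinateSubspace_le_vectorSpan_face hG huv h)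
end

section
/- Let G = (V, E) be a connected graph and Ĝ = (V, E ∪ F) an augmentation. For any cycle C = (V_C, E_C) in G and any f ∈ E_C, the cycle inequality x_f ≤ Σ_{e ∈ E_C \ {f}} x_e defines a facet of LMC(G, Ĝ) if and only if C is chordless in Ĝ. -/
open Finset

open scoped Classical

variable {V : Type*}

/-! ### Connected node sets -/

theorem preconnected_induce_of_subsingleton {G : SimpleGraph V} {X : Set V}
    (hX : X.Subsingleton) : (G.induce X).Preconnected := by
  rintro ⟨a, ha⟩ ⟨b, hb⟩
  obtain rfl := hX ha hb
  exact SimpleGraph.Reachable.refl _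

theorem preconnected_induce_insert {G : SimpleGraph V} {X : Set V} {u z : V}
    (hX : (G.induce X).Preconnected) (hz : z ∈ X) (h : G.Adj u z) :
    (G.induce (insert u X)).Preconnected := by
  have key := SimpleGraph.induce_union_connected
    (SimpleGraph.induce_pair_connected_of_adj h).preconnected hX ⟨z, by simp, hz⟩
  have : ({u, z} ∪ X : Set V) = insert u X := by
    ext t
    simp only [Set.mem_union, Set.mem_insert_iff, Set.mem_singleton_iff]
    grind
  rw [this] at key
  exact key.preconnected

theorem preconnected_induce_image_Ico {G : SimpleGraph V} {P : ℕ → V} {i j : ℕ}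
    (h : ∀ k, i ≤ k → k + 1 < j → G.Adj (P k) (P (k + 1))) :
    (G.induce (P '' Set.Ico i j)).Preconnected := by
  induction j with
  | zero => exact preconnected_induce_of_subsingleton (by simp)
  | succ j ih =>
    rcases lt_trichotomy i j with hij | rfl | hij
    · have hset : P '' Set.Ico i (j + 1) = insert (P j) (P '' Set.Ico i j) := by
        rw [← Set.image_insert_eq]
        congr 1
        ext t
        simp only [Set.mem_Ico, Set.mem_insert_iff]
        lia
      rw [hset]
      obtain ⟨k, rfl⟩ : ∃ k, j = k + 1 := ⟨j - 1, by lia⟩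
      exact preconnected_induce_insert (ih fun k h₁ h₂ => h k h₁ (by lia))
        ⟨k, ⟨by lia, by lia⟩, rfl⟩ (h k (by lia) (by lia)).symm
    · refine preconnected_induce_of_subsingleton (Set.Subsingleton.image ?_ _)
      intro a ha b hb
      simp only [Set.mem_Ico] at ha hb
      lia
    · refine preconnected_induce_of_subsingleton (Set.Subsingleton.image ?_ _)
      intro a ha b hb
      simp only [Set.mem_Ico] at ha hb
      lia

/-- The interior of a path stays connected when either or both of its ends are added. -/
theorem exists_preconnected_interior {G : SimpleGraph V} {u v : V} (p : G.Walk u v)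
    (hp : p.IsPath) (huv : u ≠ v) :
    ∃ I : Set V, (∀ t ∈ I, t ∈ p.support) ∧ u ∉ I ∧ v ∉ I ∧
      (G.induce I).Preconnected ∧ (G.induce (insert u I)).Preconnected ∧
      (G.induce (insert v I)).Preconnected ∧
      (G.induce (insert u (insert v I))).Preconnected := by
  cases p with
  | nil => exact absurd rfl huv
  | @cons _ z _ h q =>
    rw [SimpleGraph.Walk.cons_isPath_iff] at hp
    obtain ⟨hq, hu⟩ := hp
    by_cases hzv : z = v
    · subst hzv
      refine ⟨∅, by simp, by simp, by simp, ?_, ?_, ?_, ?_⟩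
      · exact preconnected_induce_of_subsingleton (by simp)
      · exact preconnected_induce_of_subsingleton (by simp)
      · exact preconnected_induce_of_subsingleton (by simp)
      · exact preconnected_induce_insert
          (preconnected_induce_of_subsingleton (by simp)) (by simp) h
    · have hsupp : ∀ t, t ∈ q.support ↔ t ∈ q.reverse.support := by simp
      have hr : q.reverse.IsPath := hq.reverse
      generalize q.reverse = r at hsupp hr
      cases r with
      | nil => exact absurd rfl hzv
      | @cons _ y _ h' r =>
        rw [SimpleGraph.Walk.cons_isPath_iff] at hr
        obtain ⟨-, hv⟩ := hr
        have hzr : z ∈ {t | t ∈ r.support} := by simp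
        have hyr : y ∈ {t | t ∈ r.support} := by simp
        have hI : (G.induce {t | t ∈ r.support}).Preconnected :=
          r.connected_induce_support.preconnected
        have hvI := preconnected_induce_insert hI hyr h'
        refine ⟨{t | t ∈ r.support}, ?_, ?_, hv, hI, preconnected_induce_insert hI hzr h,
          hvI, preconnected_induce_insert hvI (Set.mem_insert_of_mem _ hzr) h⟩
        · intro t ht
          simp only [SimpleGraph.Walk.support_cons, List.mem_cons]
          right
          rw [hsupp]
          simp only [SimpleGraph.Walk.support_cons, List.mem_cons]
          exact Or.inr ht
        · intro hur
          apply hu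
          rw [hsupp]
          simp only [SimpleGraph.Walk.support_cons, List.mem_cons]
          exact Or.inr hur

/-- A node outside `C` that is joined to `C` by a path is adjacent to a connected set that
avoids it and that meets `C` in exactly one node. -/
theorem exists_connector {G : SimpleGraph V} {C : Set V} {u c : V} (p : G.Walk u c)
    (hp : p.IsPath) (hu : u ∉ C) (hc : c ∈ C) :
    ∃ (R : Set V) (y z : V), (∀ t ∈ R, t ∈ p.support) ∧ y ∈ R ∧ y ∈ C ∧
      (∀ t ∈ R, t ∈ C → t = y) ∧ (G.induce R).Preconnected ∧ u ∉ R ∧ z ∈ R ∧ G.Adj u z ∧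
      ∀ t ∈ R, t ∉ C → ∃ q : G.Walk u t, ∀ s ∈ q.support, s ∉ C := by
  induction p with
  | nil => exact absurd hc hu
  | @cons u z c h p ih =>
    rw [SimpleGraph.Walk.cons_isPath_iff] at hp
    by_cases hz : z ∈ C
    · refine ⟨{z}, z, z, by simp, rfl, hz, by simp, ?_, ?_, rfl, h, ?_⟩
      · exact preconnected_induce_of_subsingleton (by simp)
      · rintro rfl
        exact hu hz
      · rintro t rfl ht
        exact absurd hz ht
    · obtain ⟨R, y, z', hR, hyR, hyC, huniq, hconn, hzR, hz'R, hadj, hwalk⟩ := ih hp.1 hz hc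
      refine ⟨insert z R, y, z, ?_, Set.mem_insert_of_mem _ hyR, hyC, ?_, ?_, ?_,
        Set.mem_insert _ _, h, ?_⟩
      · rintro t (rfl | ht)
        · simp
        · simp [hR t ht]
      · rintro t (rfl | ht) htC
        · exact absurd htC hz
        · exact huniq t ht htC
      · exact preconnected_induce_insert hconn hz'R hadj
      · rintro (rfl | hmem)
        · exact hp.2 (by simp)
        · exact hp.2 (hR _ hmem)
      · rintro t (rfl | ht) htC
        · exact ⟨.cons h .nil, by simp [hu, hz]⟩
        · obtain ⟨q, hq⟩ := hwalk t ht htC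
          exact ⟨.cons h q, by simpa [hu] using hq⟩

/-! ### Decompositions with at most two blocks that are not singletons -/

/-- The equivalence relation whose classes are `X`, `Y` and singletons. -/
def twoBlockSetoid (X Y : Set V) (h : Disjoint X Y) : Setoid V where
  r u v := u = v ∨ (u ∈ X ∧ v ∈ X) ∨ (u ∈ Y ∧ v ∈ Y)
  iseqv :=
    { refl := fun _ => Or.inl rfl
      symm := by
        rintro u v (rfl | h | h)
        · exact Or.inl rfl
        · exact Or.inr (Or.inl h.symm)
        · exact Or.inr (Or.inr h.symm)
      trans := by
        have hd : ∀ t, t ∈ X → t ∈ Y → False := fun _ h₁ h₂ => Set.disjoint_left.mp h h₁ h₂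
        rintro u v w (rfl | ⟨h₁, h₂⟩ | ⟨h₁, h₂⟩) (rfl | ⟨h₃, h₄⟩ | ⟨h₃, h₄⟩) <;>
          first
          | exact (hd v h₂ h₃).elim
          | exact (hd v h₃ h₂).elim
          | simp [*] }

theorem isDecomposition_twoBlockSetoid {G : SimpleGraph V} {X Y : Set V} (h : Disjoint X Y)
    (hX : (G.induce X).Preconnected) (hY : (G.induce Y).Preconnected) :
    IsDecomposition G (twoBlockSetoid X Y h).classes := by
  refine ⟨Setoid.isPartition_classes _, ?_⟩
  rintro U ⟨y, rfl⟩
  have hd : ∀ t, t ∈ X → t ∈ Y → False := fun _ h₁ h₂ => Set.disjoint_left.mp h h₁ h₂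
  have hne : Nonempty {x | twoBlockSetoid X Y h x y} := ⟨⟨y, Or.inl rfl⟩⟩
  have hpre : (G.induce {x | twoBlockSetoid X Y h x y}).Preconnected := by
    have hrel : ∀ x, twoBlockSetoid X Y h x y ↔ x = y ∨ (x ∈ X ∧ y ∈ X) ∨ (x ∈ Y ∧ y ∈ Y) :=
      fun _ => Iff.rfl
    by_cases hyX : y ∈ X
    · have : {x | twoBlockSetoid X Y h x y} = X := by
        ext x
        simp only [Set.mem_ofPred_eq, hrel]
        grind
      rwa [this]
    · by_cases hyY : y ∈ Y
      · have : {x | twoBlockSetoid X Y h x y} = Y := by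
          ext x
          simp only [Set.mem_ofPred_eq, hrel]
          grind
        rwa [this]
      · refine preconnected_induce_of_subsingleton ?_
        intro a ha b hb
        simp only [Set.mem_ofPred_eq, hrel, hyX, hyY, and_false, or_false] at ha hb
        rw [ha, hb]
  exact ⟨hpre⟩

/-- The indicator of the edges with both ends in `X`. -/
noncomputable def insideVec (X : Set V) (e : Sym2 V) : ℝ :=
  if ∀ v ∈ e, v ∈ X then 1 else 0

theorem insideVec_mk (X : Set V) (u v : V) :
    insideVec X s(u, v) = if u ∈ X ∧ v ∈ X then 1 else 0 := by
  simp [insideVec]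

theorem sameBlock_classes (r : Setoid V) (u v : V) : SameBlock r.classes u v ↔ r u v :=
  r.rel_iff_exists_classes.symm

theorem SameBlock.symm {D : Set (Set V)} {u v : V} (h : SameBlock D u v) : SameBlock D v u :=
  let ⟨U, hU, hu, hv⟩ := h
  ⟨U, hU, hv, hu⟩

theorem crosses_mk {D : Set (Set V)} {u v : V} : Crosses D s(u, v) ↔ ¬ SameBlock D u v := by
  refine ⟨?_, fun h => ⟨u, v, rfl, h⟩⟩
  rintro ⟨a, b, hab, h⟩ hs
  rcases Sym2.eq_iff.mp hab with ⟨rfl, rfl⟩ | ⟨rfl, rfl⟩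
  · exact h hs
  · exact h hs.symm

theorem multicutVec_of_adj {H : SimpleGraph V} {D : Set (Set V)} {u v : V} (h : H.Adj u v) :
    multicutVec H D s(u, v) = if SameBlock D u v then 0 else 1 := by
  simp [multicutVec, crosses_mk, h]

theorem multicutVec_of_notMem {H : SimpleGraph V} {D : Set (Set V)} {e : Sym2 V}
    (h : e ∉ H.edgeSet) : multicutVec H D e = 0 := by
  simp [multicutVec, h]

theorem multicutVec_twoBlock {H : SimpleGraph V} {X Y : Set V} (h : Disjoint X Y) {e : Sym2 V}
    (he : e ∈ H.edgeSet) :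
    multicutVec H (twoBlockSetoid X Y h).classes e = 1 - insideVec X e - insideVec Y e := by
  induction e with
  | _ u v =>
    have hd : ∀ t, t ∈ X → t ∈ Y → False := fun _ h₁ h₂ => Set.disjoint_left.mp h h₁ h₂
    have hne : u ≠ v := H.ne_of_adj he
    have hrel : twoBlockSetoid X Y h u v ↔ u = v ∨ (u ∈ X ∧ v ∈ X) ∨ (u ∈ Y ∧ v ∈ Y) := Iff.rfl
    rw [multicutVec_of_adj he, sameBlock_classes, hrel, insideVec_mk, insideVec_mk]
    by_cases hX : u ∈ X ∧ v ∈ X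
    · have hY : ¬ (u ∈ Y ∧ v ∈ Y) := fun hY => hd u hX.1 hY.1
      rw [if_pos (Or.inr (Or.inl hX)), if_pos hX, if_neg hY]
      norm_num
    · by_cases hY : u ∈ Y ∧ v ∈ Y
      · rw [if_pos (Or.inr (Or.inr hY)), if_neg hX, if_pos hY]
        norm_num
      · rw [if_neg (by tauto), if_neg hX, if_neg hY]
        norm_num

/-- Inclusion-exclusion for the indicators of the edges inside a set. -/
theorem insideVec_insert_insert {I : Set V} {u v : V} (hu : u ∉ I) (hv : v ∉ I) (huv : u ≠ v)
    (e : Sym2 V) :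
    insideVec (insert u (insert v I)) e - insideVec (insert u I) e
      - insideVec (insert v I) e + insideVec I e = if e = s(u, v) then 1 else 0 := by
  induction e with
  | _ b c =>
    simp only [insideVec_mk, Set.mem_insert_iff, Sym2.eq_iff]
    by_cases hb : b ∈ I <;> by_cases hc : c ∈ I <;> by_cases hbu : b = u <;>
      by_cases hbv : b = v <;> by_cases hcu : c = u <;> by_cases hcv : c = v <;>
      simp_all

/-- The total weight of the edges inside `X`. -/
noncomputable def insideWeight [Fintype V] (a : Sym2 V → ℝ) (X : Set V) : ℝ :=
  ∑ e, a e * insideVec X e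

theorem eq_insideWeight_of_insert_insert [Fintype V] (a : Sym2 V → ℝ) {I : Set V} {u v : V}
    (hu : u ∉ I) (hv : v ∉ I) (huv : u ≠ v) :
    a s(u, v) = insideWeight a (insert u (insert v I)) - insideWeight a (insert u I)
      - insideWeight a (insert v I) + insideWeight a I := by
  simp only [insideWeight, ← Finset.sum_sub_distrib, ← Finset.sum_add_distrib, ← mul_sub,
    ← mul_add, insideVec_insert_insert hu hv huv]
  simp

theorem sum_mul_multicutVec_twoBlock [Fintype V] {H : SimpleGraph V} {X Y : Set V}
    (h : Disjoint X Y) {a : Sym2 V → ℝ} (ha : ∀ e ∉ H.edgeSet, a e = 0) :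
    ∑ e, a e * multicutVec H (twoBlockSetoid X Y h).classes e
      = ∑ e, a e - insideWeight a X - insideWeight a Y := by
  simp only [insideWeight, ← Finset.sum_sub_distrib]
  refine Finset.sum_congr rfl fun e _ => ?_
  by_cases he : e ∈ H.edgeSet
  · rw [multicutVec_twoBlock h he]
    ring
  · simp [ha e he]

/-! ### Cycles with indexed nodes -/

/-- The nodes `P 0, …, P n` are pairwise distinct and form, in this order, a cycle of `G`. -/
structure IsIndexedCycle (G : SimpleGraph V) (P : ℕ → V) (n : ℕ) : Prop where
  two_le : 2 ≤ n
  inj : ∀ i ≤ n, ∀ j ≤ n, P i = P j → i = j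
  adj : ∀ i < n, G.Adj (P i) (P (i + 1))
  adj_close : G.Adj (P 0) (P n)

/-- The left-hand side minus the right-hand side of the cycle inequality for the edge
`s(P 0, P n)`. -/
noncomputable def cycleSlack (P : ℕ → V) (n : ℕ) : (Sym2 V → ℝ) →ₗ[ℝ] ℝ :=
  LinearMap.proj s(P 0, P n) - ∑ i ∈ Finset.range n, LinearMap.proj s(P i, P (i + 1))

theorem cycleSlack_apply (P : ℕ → V) (n : ℕ) (x : Sym2 V → ℝ) :
    cycleSlack P n x = x s(P 0, P n) - ∑ i ∈ Finset.range n, x s(P i, P (i + 1)) := by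
  simp [cycleSlack]

theorem multicutVec_twoBlock_of_arcs {H : SimpleGraph V} {P : ℕ → V} {n i : ℕ} {X Y : Set V}
    (h : Disjoint X Y) (hX : P '' Set.Ico 0 i ⊆ X) (hY : P '' Set.Ico i (n + 1) ⊆ Y)
    {j k : ℕ} (hjk : j < k) (hk : k ≤ n) (hadj : H.Adj (P j) (P k)) :
    multicutVec H (twoBlockSetoid X Y h).classes s(P j, P k)
      = if j < i ∧ i ≤ k then 1 else 0 := by
  have hd : ∀ t, t ∈ X → t ∈ Y → False := fun _ h₁ h₂ => Set.disjoint_left.mp h h₁ h₂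
  have hlt : ∀ l ≤ n, l < i → P l ∈ X := fun l hl hli => hX ⟨l, ⟨by lia, hli⟩, rfl⟩
  have hge : ∀ l ≤ n, i ≤ l → P l ∈ Y := fun l hl hli => hY ⟨l, ⟨hli, by lia⟩, rfl⟩
  rw [multicutVec_of_adj hadj, sameBlock_classes]
  have hrel : twoBlockSetoid X Y h (P j) (P k) ↔
    P j = P k ∨ (P j ∈ X ∧ P k ∈ X) ∨ (P j ∈ Y ∧ P k ∈ Y) := Iff.rfl
  have hne : P j ≠ P k := hadj.ne
  by_cases hji : j < i
  · by_cases hki : i ≤ k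
    · have h₁ := hlt j (by lia) hji
      have h₂ := hge k hk hki
      rw [if_neg, if_pos ⟨hji, hki⟩]
      rw [hrel]
      rintro (h' | h' | h')
      · exact hne h'
      · exact hd _ h'.2 h₂
      · exact hd _ h₁ h'.1
    · rw [if_pos, if_neg (by lia)]
      exact Or.inr (Or.inl ⟨hlt j (by lia) hji, hlt k hk (by lia)⟩)
  · rw [if_pos, if_neg (by lia)]
    exact Or.inr (Or.inr ⟨hge j (by lia) (by lia), hge k hk (by lia)⟩)

namespace IsIndexedCycle

variable {G H : SimpleGraph V} {P : ℕ → V} {n : ℕ}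

theorem mono (hC : IsIndexedCycle G P n) (hle : G ≤ H) : IsIndexedCycle H P n :=
  ⟨hC.two_le, hC.inj, fun i hi => hle (hC.adj i hi), hle hC.adj_close⟩

theorem mem_image_Ico (hC : IsIndexedCycle G P n) {i j k : ℕ} (hj : j ≤ n + 1) (hk : k ≤ n) :
    P k ∈ P '' Set.Ico i j ↔ i ≤ k ∧ k < j := by
  constructor
  · rintro ⟨l, ⟨h₁, h₂⟩, hl⟩
    obtain rfl := hC.inj l (by lia) k hk hl
    exact ⟨h₁, h₂⟩
  · intro h
    exact ⟨k, h, rfl⟩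

theorem preconnected_arc (hC : IsIndexedCycle G P n) {i j : ℕ} (hj : j ≤ n + 1) :
    (G.induce (P '' Set.Ico i j)).Preconnected :=
  preconnected_induce_image_Ico fun k _ hk => hC.adj k (by lia)

theorem disjoint_arc (hC : IsIndexedCycle G P n) (i : ℕ) (hi : i ≤ n + 1) :
    Disjoint (P '' Set.Ico 0 i) (P '' Set.Ico i (n + 1)) := by
  rw [Set.disjoint_left]
  rintro _ ⟨k, hk, rfl⟩ h
  simp only [Set.mem_Ico] at hk
  rw [hC.mem_image_Ico le_rfl (by lia)] at h
  lia

theorem cycleSlack_split (hC : IsIndexedCycle H P n) {i : ℕ} (hi : i ≤ n + 1) {X Y : Set V}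
    (h : Disjoint X Y) (hX : P '' Set.Ico 0 i ⊆ X) (hY : P '' Set.Ico i (n + 1) ⊆ Y) :
    cycleSlack P n (multicutVec H (twoBlockSetoid X Y h).classes) = 0 := by
  have h2 := hC.two_le
  rw [cycleSlack_apply, multicutVec_twoBlock_of_arcs h hX hY (by lia) le_rfl hC.adj_close]
  have hsum : ∑ j ∈ Finset.range n,
      multicutVec H (twoBlockSetoid X Y h).classes s(P j, P (j + 1))
        = ∑ j ∈ Finset.range n, if j + 1 = i then 1 else 0 := by
    refine Finset.sum_congr rfl fun j hj => ?_
    rw [Finset.mem_range] at hj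
    rw [multicutVec_twoBlock_of_arcs h hX hY (by lia) hj (hC.adj j hj)]
    exact if_congr (by lia) rfl rfl
  rw [hsum]
  rcases Nat.eq_zero_or_pos i with rfl | hpos
  · simp
  · obtain ⟨k, rfl⟩ : ∃ k, i = k + 1 := ⟨i - 1, by lia⟩
    simp only [Nat.add_right_cancel_iff, Finset.sum_ite_eq', Finset.mem_range]
    by_cases hk : k < n
    · rw [if_pos ⟨hpos, hk⟩, if_pos hk, sub_self]
    · rw [if_neg (by lia), if_neg hk, sub_self]

/-- A weight function that is orthogonal to the vertices of the face defined by the cycle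
inequality. -/
def IsOrthogonal [Fintype V] (G H : SimpleGraph V) (P : ℕ → V) (n : ℕ) (a : Sym2 V → ℝ) : Prop :=
  (∀ e ∉ H.edgeSet, a e = 0) ∧ a s(P 0, P n) = 0 ∧
    ∀ D, IsDecomposition G D → cycleSlack P n (multicutVec H D) = 0 →
      ∑ e, a e * multicutVec H D e = 0

variable [Fintype V] {a : Sym2 V → ℝ}

theorem insideWeight_add_insideWeight (hC : IsIndexedCycle H P n)
    (ha : IsOrthogonal G H P n a) {i : ℕ} (hi : i ≤ n + 1) {X Y : Set V} (h : Disjoint X Y)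
    (hX : P '' Set.Ico 0 i ⊆ X) (hY : P '' Set.Ico i (n + 1) ⊆ Y)
    (hXc : (G.induce X).Preconnected) (hYc : (G.induce Y).Preconnected) :
    insideWeight a X + insideWeight a Y = ∑ e, a e := by
  have := ha.2.2 _ (isDecomposition_twoBlockSetoid h hXc hYc) (hC.cycleSlack_split hi h hX hY)
  rw [sum_mul_multicutVec_twoBlock h ha.1] at this
  linarith

/-- The weight of an edge without ends on the cycle vanishes. -/
theorem weight_eq_zero_of_notMem_of_notMem (hC : IsIndexedCycle G P n) (hle : G ≤ H)
    (hG : G.Connected) (ha : IsOrthogonal G H P n a) {u v : V} (huv : u ≠ v)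
    (hu : u ∉ P '' Set.Ico 0 (n + 1)) (hv : v ∉ P '' Set.Ico 0 (n + 1)) : a s(u, v) = 0 := by
  have hCc : (G.induce (P '' Set.Ico 0 (n + 1))).Preconnected := hC.preconnected_arc le_rfl
  have hP0 : P 0 ∈ P '' Set.Ico 0 (n + 1) := ⟨0, by simp, rfl⟩
  generalize hCdef : P '' Set.Ico 0 (n + 1) = C at *
  have key : ∀ X Y : Set V, Disjoint X Y → C ⊆ X → (G.induce X).Preconnected →
      (G.induce Y).Preconnected → insideWeight a X + insideWeight a Y = ∑ e, a e := by
    intro X Y h hX hXc hYc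
    exact (hC.mono hle).insideWeight_add_insideWeight ha le_rfl h (hCdef ▸ hX) (by simp) hXc hYc
  by_cases hreach : ∃ q : G.Walk u v, ∀ s ∈ q.support, s ∉ C
  · obtain ⟨q, hq⟩ := hreach
    obtain ⟨I, hI, huI, hvI, h₀, h₁, h₂, h₃⟩ :=
      exists_preconnected_interior q.bypass q.bypass_isPath huv
    have hIC : ∀ t ∈ I, t ∉ C := fun t ht => hq t (q.support_bypass_subset_support (hI t ht))
    have hdisj : ∀ Y : Set V, (∀ t ∈ Y, t = u ∨ t = v ∨ t ∈ I) → Disjoint C Y := by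
      intro Y hY
      rw [Set.disjoint_right]
      intro t ht
      rcases hY t ht with rfl | rfl | h
      exacts [hu, hv, hIC t h]
    have k₀ := key C _ (hdisj I (by tauto)) le_rfl hCc h₀
    have k₁ := key C _ (hdisj (insert u I)
      (by simp only [Set.mem_insert_iff]; tauto)) le_rfl hCc h₁
    have k₂ := key C _ (hdisj (insert v I)
      (by simp only [Set.mem_insert_iff]; tauto)) le_rfl hCc h₂
    have k₃ := key C _ (hdisj (insert u (insert v I))
      (by simp only [Set.mem_insert_iff]; tauto)) le_rfl hCc h₃
    rw [eq_insideWeight_of_insert_insert a huI hvI huv]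
    linarith
  · have hreach' : ¬ ∃ q : G.Walk v u, ∀ s ∈ q.support, s ∉ C := by
      rintro ⟨q, hq⟩
      exact hreach ⟨q.reverse, by simpa using hq⟩
    obtain ⟨pu⟩ := hG.preconnected u (P 0)
    obtain ⟨pv⟩ := hG.preconnected v (P 0)
    obtain ⟨R, y, z, -, hyR, hyC, -, hRc, huR, hzR, huz, hRw⟩ :=
      exists_connector pu.bypass pu.bypass_isPath hu hP0
    obtain ⟨S, y', z', -, hyS, hyC', -, hSc, hvS, hzS, hvz, hSw⟩ :=
      exists_connector pv.bypass pv.bypass_isPath hv hP0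
    have hI : (G.induce (C ∪ R ∪ S)).Preconnected :=
      (SimpleGraph.induce_union_connected (SimpleGraph.induce_union_connected hCc hRc
        ⟨y, hyC, hyR⟩).preconnected hSc ⟨y', Or.inl hyC', hyS⟩).preconnected
    have hCI : C ⊆ C ∪ R ∪ S := fun t ht => Or.inl (Or.inl ht)
    have hzI : z ∈ C ∪ R ∪ S := Or.inl (Or.inr hzR)
    have hzI' : z' ∈ C ∪ R ∪ S := Or.inr hzS
    have huI : u ∉ C ∪ R ∪ S := by
      rintro ((h | h) | h)
      exacts [hu h, huR h, hreach' (hSw u h hu)]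
    have hvI : v ∉ C ∪ R ∪ S := by
      rintro ((h | h) | h)
      exacts [hv h, hreach (hRw v h hv), hvS h]
    generalize C ∪ R ∪ S = I at *
    have hempty : (G.induce (∅ : Set V)).Preconnected :=
      preconnected_induce_of_subsingleton (by simp)
    have hvI' := preconnected_induce_insert hI hzI' hvz
    have k₀ := key I ∅ (by simp) hCI hI hempty
    have k₁ := key (insert u I) ∅ (by simp) (hCI.trans (Set.subset_insert _ _))
      (preconnected_induce_insert hI hzI huz) hempty
    have k₂ := key (insert v I) ∅ (by simp) (hCI.trans (Set.subset_insert _ _)) hvI' hempty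
    have k₃ := key (insert u (insert v I)) ∅ (by simp)
      ((hCI.trans (Set.subset_insert _ _)).trans (Set.subset_insert _ _))
      (preconnected_induce_insert hvI' (Set.mem_insert_of_mem _ hzI) huz) hempty
    rw [eq_insideWeight_of_insert_insert a huI hvI huv]
    linarith

/-- The weight of an edge with exactly one end on the cycle vanishes. -/
theorem weight_eq_zero_of_notMem_of_mem (hC : IsIndexedCycle G P n) (hle : G ≤ H)
    (hG : G.Connected) (ha : IsOrthogonal G H P n a) {u : V} {j : ℕ}
    (hu : u ∉ P '' Set.Ico 0 (n + 1)) (hj : j ≤ n) : a s(u, P j) = 0 := by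
  obtain ⟨pu⟩ := hG.preconnected u (P 0)
  obtain ⟨R, y, z, -, hyR, ⟨k, hk, rfl⟩, hRC, hRc, huR, hzR, huz, -⟩ :=
    exists_connector pu.bypass pu.bypass_isPath hu ⟨0, by simp, rfl⟩
  simp only [Set.mem_Ico] at hk
  have hkn : k ≤ n := by lia
  have hRC' : ∀ l ≤ n, P l ∈ R → l = k := by
    intro l hl hlR
    exact hC.inj l hl k hkn (hRC _ hlR ⟨l, ⟨by lia, by lia⟩, rfl⟩)
  have huP : ∀ l ≤ n, u ≠ P l := by
    rintro l hl rfl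
    exact hu ⟨l, ⟨by lia, by lia⟩, rfl⟩
  have huarc : ∀ i l, l ≤ n + 1 → u ∉ P '' Set.Ico i l ∪ R := by
    rintro i l hl (⟨m, hm, rfl⟩ | h)
    · simp only [Set.mem_Ico] at hm
      exact huP m (by lia) rfl
    · exact huR h
  have harc : ∀ i l, i ≤ k → k < l → l ≤ n + 1 → (G.induce (P '' Set.Ico i l ∪ R)).Preconnected :=
    fun i l hi hl hln => (SimpleGraph.induce_union_connected (hC.preconnected_arc hln) hRc
      ⟨P k, ⟨k, ⟨hi, hl⟩, rfl⟩, hyR⟩).preconnected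
  have hdisj : ∀ i l i' l', k < l → l ≤ n + 1 → l' ≤ n + 1 → i ≤ k → l ≤ i' ∨ l' ≤ i →
      Disjoint (insert u (P '' Set.Ico i l ∪ R)) (P '' Set.Ico i' l') := by
    intro i l i' l' hkl hl hl' hik h
    rw [Set.disjoint_right]
    rintro _ ⟨m, hm, rfl⟩ hmem
    simp only [Set.mem_Ico] at hm
    rcases hmem with h' | h' | h'
    · exact huP m (by lia) h'.symm
    · rw [hC.mem_image_Ico hl (by lia)] at h'
      lia
    · have := hRC' m (by lia) h'
      lia
  have hlow : ∀ l, k < l → l ≤ n + 1 →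
      insideWeight a (insert u (P '' Set.Ico 0 l ∪ R)) = insideWeight a (P '' Set.Ico 0 l ∪ R) := by
    intro l hkl hl
    have hd := hdisj 0 l l (n + 1) hkl hl le_rfl (by lia) (Or.inl le_rfl)
    have hs : P '' Set.Ico 0 l ⊆ P '' Set.Ico 0 l ∪ R := Set.subset_union_left
    have h₁ := (hC.mono hle).insideWeight_add_insideWeight ha hl hd
      (hs.trans (Set.subset_insert _ _)) le_rfl
      (preconnected_induce_insert (harc 0 l (by lia) hkl hl) (Or.inr hzR) huz)
      (hC.preconnected_arc le_rfl)
    have h₂ := (hC.mono hle).insideWeight_add_insideWeight ha hl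
      (hd.mono_left (Set.subset_insert _ _)) hs le_rfl (harc 0 l (by lia) hkl hl)
      (hC.preconnected_arc le_rfl)
    linarith
  have hhigh : ∀ i ≤ k, insideWeight a (insert u (P '' Set.Ico i (n + 1) ∪ R))
      = insideWeight a (P '' Set.Ico i (n + 1) ∪ R) := by
    intro i hik
    have hd := (hdisj i (n + 1) 0 i (by lia) le_rfl (by lia) hik (Or.inr le_rfl)).symm
    have hs : P '' Set.Ico i (n + 1) ⊆ P '' Set.Ico i (n + 1) ∪ R := Set.subset_union_left
    have h₁ := (hC.mono hle).insideWeight_add_insideWeight ha (by lia) hd le_rfl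
      (hs.trans (Set.subset_insert _ _)) (hC.preconnected_arc (by lia))
      (preconnected_induce_insert (harc i (n + 1) hik (by lia) le_rfl) (Or.inr hzR) huz)
    have h₂ := (hC.mono hle).insideWeight_add_insideWeight ha (by lia)
      (hd.mono_right (Set.subset_insert _ _)) le_rfl hs (hC.preconnected_arc (by lia))
      (harc i (n + 1) hik (by lia) le_rfl)
    linarith
  have hne : ∀ j ≤ n, j ≠ k → a s(u, P j) = 0 := by
    intro j hj hjk
    rcases lt_or_gt_of_ne hjk with hlt | hgt
    · have hset : P '' Set.Ico j (n + 1) ∪ R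
          = insert (P j) (P '' Set.Ico (j + 1) (n + 1) ∪ R) := by
        rw [← Set.insert_union, ← Set.image_insert_eq]
        congr 2
        ext t
        simp only [Set.mem_Ico, Set.mem_insert_iff]
        lia
      have hjI : P j ∉ P '' Set.Ico (j + 1) (n + 1) ∪ R := by
        rintro (h | h)
        · rw [hC.mem_image_Ico le_rfl hj] at h
          lia
        · exact hjk (hRC' j hj h)
      have h₁ := hhigh j hlt.le
      rw [hset] at h₁
      rw [eq_insideWeight_of_insert_insert a (huarc _ _ le_rfl) hjI (huP j hj), h₁,
        hhigh (j + 1) hlt]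
      ring
    · have hset : P '' Set.Ico 0 (j + 1) ∪ R = insert (P j) (P '' Set.Ico 0 j ∪ R) := by
        rw [← Set.insert_union, ← Set.image_insert_eq]
        congr 2
        ext t
        simp only [Set.mem_Ico, Set.mem_insert_iff]
        lia
      have hjI : P j ∉ P '' Set.Ico 0 j ∪ R := by
        rintro (h | h)
        · rw [hC.mem_image_Ico (by lia) hj] at h
          lia
        · exact hjk (hRC' j hj h)
      have h₁ := hlow (j + 1) (by lia) (by lia)
      rw [hset] at h₁
      rw [eq_insideWeight_of_insert_insert a (huarc 0 j (by lia)) hjI (huP j hj), h₁,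
        hlow j hgt (by lia)]
      ring
  by_cases hjk : j = k
  · subst hjk
    have h := hlow (n + 1) (by lia) le_rfl
    have huI := huarc 0 (n + 1) le_rfl
    have hkI : P j ∈ P '' Set.Ico 0 (n + 1) ∪ R := Or.inr hyR
    have hz : ∀ t ∈ P '' Set.Ico 0 (n + 1) ∪ R, t ≠ P j → a s(u, t) = 0 := by
      intro t ht htj
      by_cases htC : t ∈ P '' Set.Ico 0 (n + 1)
      · obtain ⟨l, hl, rfl⟩ := htC
        simp only [Set.mem_Ico] at hl
        exact hne l (by lia) (fun h => htj (h ▸ rfl))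
      · refine hC.weight_eq_zero_of_notMem_of_notMem hle hG ha ?_ hu htC
        rintro rfl
        exact huI ht
    generalize P '' Set.Ico 0 (n + 1) ∪ R = I at *
    have hdiag : a s(u, u) = 0 := ha.1 _ (by simp)
    simp only [insideWeight] at h
    rw [← sub_eq_zero, ← Finset.sum_sub_distrib, Finset.sum_eq_single s(u, P j)] at h
    · have h₁ : insideVec (insert u I) s(u, P j) = 1 := by
        rw [insideVec_mk, if_pos ⟨Set.mem_insert _ _, Set.mem_insert_of_mem _ hkI⟩]
      have h₂ : insideVec I s(u, P j) = 0 := by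
        rw [insideVec_mk, if_neg fun h => huI h.1]
      rw [h₁, h₂] at h
      linarith
    · intro e _ hej
      induction e with
      | _ b c =>
        have hedge : ∀ t, t ∈ insert u I → s(u, t) ≠ s(u, P j) → a s(u, t) = 0 := by
          rintro t (rfl | ht) hne
          · exact hdiag
          · exact hz t ht (by rintro rfl; exact hne rfl)
        simp only [insideVec_mk]
        by_cases hbu : b = u
        · subst hbu
          by_cases hc : c ∈ insert b I
          · simp [hedge c hc hej]
          · have : c ∉ I := fun h => hc (Set.mem_insert_of_mem _ h)
            simp [hc, this]
        · by_cases hcu : c = u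
          · subst hcu
            rw [Sym2.eq_swap] at hej ⊢
            by_cases hb : b ∈ insert c I
            · simp [hedge b hb hej]
            · have : b ∉ I := fun h => hb (Set.mem_insert_of_mem _ h)
              simp [hb, this]
          · simp [hbu, hcu]
    · simp
  · exact hne j hj hjk

/-- If the cycle is chordless, the face is only orthogonal to the trivial weights. -/
theorem weight_eq_zero (hC : IsIndexedCycle G P n) (hle : G ≤ H) (hG : G.Connected)
    (ha : IsOrthogonal G H P n a)
    (hchord : ∀ i j, i < j → j ≤ n → H.Adj (P i) (P j) → j = i + 1 ∨ i = 0 ∧ j = n) : a = 0 := by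
  have hne : ∀ e, (∀ i < n, e ≠ s(P i, P (i + 1))) → a e = 0 := by
    intro e he
    by_cases heH : e ∈ H.edgeSet
    · induction e with
      | _ u v =>
        have huv : u ≠ v := H.ne_of_adj heH
        by_cases hu : u ∈ P '' Set.Ico 0 (n + 1)
        · by_cases hv : v ∈ P '' Set.Ico 0 (n + 1)
          · have hsym : ∀ i j, i < j → j ≤ n → H.Adj (P i) (P j) →
                (∀ k < n, s(P i, P j) ≠ s(P k, P (k + 1))) → a s(P i, P j) = 0 := by
              intro i j hij hj hadj hne
              rcases hchord i j hij hj hadj with rfl | ⟨rfl, rfl⟩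
              · exact absurd rfl (hne i (by lia))
              · exact ha.2.1
            obtain ⟨i, hi, rfl⟩ := hu
            obtain ⟨j, hj, rfl⟩ := hv
            simp only [Set.mem_Ico] at hi hj
            rcases lt_trichotomy i j with h | rfl | h
            · exact hsym i j h (by lia) heH he
            · exact absurd rfl huv
            · rw [Sym2.eq_swap] at he ⊢
              exact hsym j i h (by lia) heH.symm he
          · obtain ⟨i, hi, rfl⟩ := hu
            simp only [Set.mem_Ico] at hi
            rw [Sym2.eq_swap]
            exact hC.weight_eq_zero_of_notMem_of_mem hle hG ha hv (by lia)
        · by_cases hv : v ∈ P '' Set.Ico 0 (n + 1)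
          · obtain ⟨i, hi, rfl⟩ := hv
            simp only [Set.mem_Ico] at hi
            exact hC.weight_eq_zero_of_notMem_of_mem hle hG ha hu (by lia)
          · exact hC.weight_eq_zero_of_notMem_of_notMem hle hG ha huv hu hv
    · exact ha.1 e heH
  funext e
  by_cases he : ∀ i < n, e ≠ s(P i, P (i + 1))
  · exact hne e he
  · push Not at he
    obtain ⟨i, hi, rfl⟩ := he
    have hd := hC.disjoint_arc (i + 1) (by lia)
    have h := ha.2.2 _ (isDecomposition_twoBlockSetoid hd (hC.preconnected_arc (by lia))
      (hC.preconnected_arc le_rfl))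
      ((hC.mono hle).cycleSlack_split (by lia) hd le_rfl le_rfl)
    rw [Finset.sum_eq_single s(P i, P (i + 1))] at h
    · rw [multicutVec_twoBlock_of_arcs hd le_rfl le_rfl (by lia) (by lia) (hle (hC.adj i hi)),
        if_pos ⟨by lia, le_rfl⟩] at h
      simpa using h
    · intro e _ hei
      by_cases he : ∀ j < n, e ≠ s(P j, P (j + 1))
      · rw [hne e he, zero_mul]
      · push Not at he
        obtain ⟨j, hj, rfl⟩ := he
        have hij : j ≠ i := by
          rintro rfl
          exact hei rfl
        rw [multicutVec_twoBlock_of_arcs hd le_rfl le_rfl (by lia) (by lia) (hle (hC.adj j hj)),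
          if_neg (by lia), mul_zero]
    · simp

end IsIndexedCycle

/-! ### Dimensions of coordinate subspaces -/

theorem finrank_le_card_of_forall_eq_zero {ι : Type*} [Fintype ι] (W : Submodule ℝ (ι → ℝ))
    (T : Finset ι) (h : ∀ x ∈ W, (∀ t ∈ T, x t = 0) → x = 0) : Module.finrank ℝ W ≤ T.card := by
  have hinj : Function.Injective
      ((LinearMap.funLeft ℝ ℝ (Subtype.val : T → ι)).comp W.subtype) := by
    rw [injective_iff_map_eq_zero]
    rintro ⟨x, hx⟩ h0
    ext1
    exact h x hx fun t ht => congrFun h0 ⟨t, ht⟩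
  simpa using LinearMap.finrank_le_finrank_of_injective hinj

theorem card_le_finrank_of_forall_eq_zero {ι : Type*} [Fintype ι] (W : Submodule ℝ (ι → ℝ))
    (T : Finset ι) (h : ∀ a : ι → ℝ, (∀ e ∉ T, a e = 0) → (∀ x ∈ W, ∑ e, a e * x e = 0) → a = 0) :
    T.card ≤ Module.finrank ℝ W := by
  set ρ := (LinearMap.funLeft ℝ ℝ (Subtype.val : T → ι)).comp W.subtype with hρ
  have hsurj : LinearMap.range ρ = ⊤ := by
    by_contra hne
    obtain ⟨g, hg, hker⟩ := Submodule.exists_le_ker_of_lt_top _ (lt_top_iff_ne_top.mpr hne)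
    apply hg
    have ha := h (fun e => if he : e ∈ T then g (Pi.single ⟨e, he⟩ 1) else 0)
      (fun e he => by simp [he]) ?_
    · refine LinearMap.pi_ext' fun t => LinearMap.ext_ring ?_
      have := congrFun ha t
      simpa using this
    · intro x hx
      have h0 : g (ρ ⟨x, hx⟩) = 0 := hker ⟨_, rfl⟩
      rw [LinearMap.pi_apply_eq_sum_univ g] at h0
      rw [← Finset.sum_subset (Finset.subset_univ T), ← Finset.sum_coe_sort T]
      · rw [← h0]
        refine Finset.sum_congr rfl fun t _ => ?_
        simp only [t.2, dif_pos, smul_eq_mul, hρ]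
        rw [mul_comm]
        congr 2
        funext s
        simp [Pi.single_apply, eq_comm]
      · intro e _ he
        simp [he]
  simpa using LinearMap.finrank_le_finrank_of_surjective (LinearMap.range_eq_top.mp hsurj)

/-! ### Valid inequalities and the face of a cycle inequality -/

theorem SameBlock.trans_s7 {D : Set (Set V)} (hD : Setoid.IsPartition D) {u v w : V}
    (huv : SameBlock D u v) (hvw : SameBlock D v w) : SameBlock D u w := by
  obtain ⟨U, hU, hu, hv⟩ := huv
  obtain ⟨U', hU', hv', hw⟩ := hvw
  obtain rfl := Setoid.eq_of_mem_eqv_class hD.2 hU hv hU' hv'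
  exact ⟨U, hU, hu, hw⟩

theorem ite_sameBlock_le_add {D : Set (Set V)} (hD : Setoid.IsPartition D) (u v w : V) :
    (if SameBlock D u w then (0 : ℝ) else 1)
      ≤ (if SameBlock D u v then 0 else 1) + if SameBlock D v w then 0 else 1 := by
  have := @SameBlock.trans_s7 V D hD u v w
  split_ifs <;> first | tauto | norm_num

theorem ite_sameBlock_le_sum {D : Set (Set V)} (hD : Setoid.IsPartition D) (P : ℕ → V) {i j : ℕ}
    (hij : i ≤ j) :
    (if SameBlock D (P i) (P j) then (0 : ℝ) else 1)
      ≤ ∑ k ∈ Finset.Ico i j, if SameBlock D (P k) (P (k + 1)) then 0 else 1 := by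
  induction j, hij using Nat.le_induction with
  | base =>
    obtain ⟨U, ⟨hU, hi⟩, -⟩ := hD.2 (P i)
    have : SameBlock D (P i) (P i) := ⟨U, hU, hi, hi⟩
    simp [this]
  | succ j hij ih =>
    rw [Finset.sum_Ico_succ_top hij]
    have := ite_sameBlock_le_add hD (P i) (P j) (P (j + 1))
    linarith

theorem le_zero_of_mem_LMC {G H : SimpleGraph V} (l : (Sym2 V → ℝ) →ₗ[ℝ] ℝ)
    (h : ∀ D, IsDecomposition G D → l (multicutVec H D) ≤ 0) {x : Sym2 V → ℝ}
    (hx : x ∈ LMC G H) : l x ≤ 0 := by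
  refine convexHull_min ?_ (convex_halfSpace_le l.isLinear 0) hx
  rintro _ ⟨D, hD, rfl⟩
  exact h D hD

theorem eq_zero_of_mem_LMC_of_notMem {G H : SimpleGraph V} {e : Sym2 V} (he : e ∉ H.edgeSet)
    {x : Sym2 V → ℝ} (hx : x ∈ LMC G H) : x e = 0 := by
  have h₁ := le_zero_of_mem_LMC (G := G) (H := H) (LinearMap.proj e)
    (fun D _ => (multicutVec_of_notMem he).le) hx
  have h₂ := le_zero_of_mem_LMC (G := G) (H := H) (-LinearMap.proj e)
    (fun D _ => by simp [multicutVec_of_notMem he]) hx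
  simp only [LinearMap.neg_apply, LinearMap.proj_apply] at h₁ h₂
  linarith

/-- The slack of the inequality of the subpath of `P` between the nodes `P i` and `P j`. -/
noncomputable def pathSlack (P : ℕ → V) (i j : ℕ) : (Sym2 V → ℝ) →ₗ[ℝ] ℝ :=
  LinearMap.proj s(P i, P j) - ∑ k ∈ Finset.Ico i j, LinearMap.proj s(P k, P (k + 1))

theorem pathSlack_apply (P : ℕ → V) (i j : ℕ) (x : Sym2 V → ℝ) :
    pathSlack P i j x = x s(P i, P j) - ∑ k ∈ Finset.Ico i j, x s(P k, P (k + 1)) := by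
  simp [pathSlack]

namespace IsIndexedCycle

variable {G H : SimpleGraph V} {P : ℕ → V} {n : ℕ}

theorem sum_Ico_multicutVec (hC : IsIndexedCycle H P n) (D : Set (Set V)) {i j : ℕ} (hj : j ≤ n) :
    ∑ k ∈ Finset.Ico i j, multicutVec H D s(P k, P (k + 1))
      = ∑ k ∈ Finset.Ico i j, if SameBlock D (P k) (P (k + 1)) then (0 : ℝ) else 1 := by
  refine Finset.sum_congr rfl fun k hk => multicutVec_of_adj (hC.adj k ?_)
  rw [Finset.mem_Ico] at hk
  lia

theorem pathSlack_le_zero (hC : IsIndexedCycle H P n) {i j : ℕ} (hij : i ≤ j) (hj : j ≤ n)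
    (hadj : H.Adj (P i) (P j)) {x : Sym2 V → ℝ} (hx : x ∈ LMC G H) : pathSlack P i j x ≤ 0 := by
  refine le_zero_of_mem_LMC (pathSlack P i j) (fun D hD => ?_) hx
  rw [pathSlack_apply, multicutVec_of_adj hadj, hC.sum_Ico_multicutVec D hj, sub_nonpos]
  exact ite_sameBlock_le_sum hD.1 P hij

theorem cycleSlack_eq_pathSlack (P : ℕ → V) (n : ℕ) : cycleSlack P n = pathSlack P 0 n := by
  rw [cycleSlack, pathSlack, Finset.range_eq_Ico]

theorem cycleSlack_le_zero (hC : IsIndexedCycle H P n) {x : Sym2 V → ℝ} (hx : x ∈ LMC G H) :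
    cycleSlack P n x ≤ 0 := by
  rw [cycleSlack_eq_pathSlack]
  exact hC.pathSlack_le_zero (Nat.zero_le n) le_rfl hC.adj_close hx

/-- A chord splits the cycle inequality into two valid inequalities. -/
theorem cycleSlack_le_pathSlack (hC : IsIndexedCycle H P n) {i j : ℕ} (hij : i ≤ j) (hj : j ≤ n)
    (hadj : H.Adj (P i) (P j)) {x : Sym2 V → ℝ} (hx : x ∈ LMC G H) :
    cycleSlack P n x ≤ pathSlack P i j x := by
  have h := le_zero_of_mem_LMC (cycleSlack P n - pathSlack P i j) (fun D hD => ?_) hx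
  · rw [LinearMap.sub_apply] at h
    linarith
  · rw [LinearMap.sub_apply, cycleSlack_eq_pathSlack, pathSlack_apply, pathSlack_apply,
      multicutVec_of_adj hadj, multicutVec_of_adj hC.adj_close, hC.sum_Ico_multicutVec D le_rfl,
      hC.sum_Ico_multicutVec D hj, ← Finset.sum_Ico_consecutive _ (Nat.zero_le j) hj,
      ← Finset.sum_Ico_consecutive _ (Nat.zero_le i) hij]
    have h₁ := ite_sameBlock_le_sum hD.1 P (Nat.zero_le i)
    have h₂ := ite_sameBlock_le_sum hD.1 P hj
    have h₃ := ite_sameBlock_le_add hD.1 (P 0) (P i) (P n)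
    have h₄ := ite_sameBlock_le_add hD.1 (P i) (P j) (P n)
    linarith

/-- The direction of the face defined by the cycle inequality. -/
noncomputable def faceDirection (G H : SimpleGraph V) (P : ℕ → V) (n : ℕ) :
    Submodule ℝ (Sym2 V → ℝ) :=
  (affineSpan ℝ {x | x ∈ LMC G H ∧ cycleSlack P n x = 0}).direction

theorem faceDirection_le_ker (l : (Sym2 V → ℝ) →ₗ[ℝ] ℝ)
    (h : ∀ x ∈ LMC G H, cycleSlack P n x = 0 → l x = 0) {x : Sym2 V → ℝ}
    (hx : x ∈ faceDirection G H P n) : l x = 0 := by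
  rw [faceDirection, direction_affineSpan, vectorSpan_def] at hx
  refine (Submodule.span_le (p := LinearMap.ker l)).mpr ?_ hx
  rintro _ ⟨y, hy, z, hz, rfl⟩
  simp [h y hy.1 hy.2, h z hz.1 hz.2]

theorem apply_eq_zero_of_mem_faceDirection {e : Sym2 V} (he : e ∉ H.edgeSet) {x : Sym2 V → ℝ}
    (hx : x ∈ faceDirection G H P n) : x e = 0 :=
  faceDirection_le_ker (LinearMap.proj e) (fun _ hy _ => eq_zero_of_mem_LMC_of_notMem he hy) hx

theorem eq_sum_of_mem_faceDirection {x : Sym2 V → ℝ} (hx : x ∈ faceDirection G H P n) :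
    x s(P 0, P n) = ∑ i ∈ Finset.range n, x s(P i, P (i + 1)) := by
  rw [← sub_eq_zero, ← cycleSlack_apply]
  exact faceDirection_le_ker _ (fun _ _ h => h) hx

theorem multicutVec_mem_faceDirection (hC : IsIndexedCycle G P n) (hle : G ≤ H)
    (hG : G.Connected) {D : Set (Set V)} (hD : IsDecomposition G D)
    (h : cycleSlack P n (multicutVec H D) = 0) : multicutVec H D ∈ faceDirection G H P n := by
  have hd : Disjoint (Set.univ : Set V) ∅ := by simp
  have huniv : (G.induce (Set.univ : Set V)).Preconnected := by
    exact (SimpleGraph.induceUnivIso G).preconnected_iff.mpr hG.preconnected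
  have hempty : (G.induce (∅ : Set V)).Preconnected :=
    preconnected_induce_of_subsingleton (by simp)
  have h0 := (hC.mono hle).cycleSlack_split le_rfl hd (Set.subset_univ _) (by simp)
  have hzero : multicutVec H (twoBlockSetoid _ _ hd).classes = 0 := by
    funext e
    by_cases he : e ∈ H.edgeSet
    · rw [multicutVec_twoBlock hd he]
      induction e with
      | _ u v => simp [insideVec_mk]
    · simp [multicutVec_of_notMem he]
  have hmem := isDecomposition_twoBlockSetoid hd huniv hempty
  have := vsub_mem_vectorSpan ℝ (s := {x | x ∈ LMC G H ∧ cycleSlack P n x = 0})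
    ⟨subset_convexHull ℝ _ ⟨D, hD, rfl⟩, h⟩ ⟨subset_convexHull ℝ _ ⟨_, hmem, rfl⟩, h0⟩
  rw [hzero, vsub_eq_sub, sub_zero] at this
  rwa [faceDirection, direction_affineSpan]

theorem eq_of_edge_eq (hC : IsIndexedCycle G P n) {i j k l : ℕ} (hij : i < j) (hj : j ≤ n)
    (hkl : k < l) (hl : l ≤ n) (h : s(P i, P j) = s(P k, P l)) : i = k ∧ j = l := by
  rcases Sym2.eq_iff.mp h with ⟨h₁, h₂⟩ | ⟨h₁, h₂⟩
  · exact ⟨hC.inj i (by lia) k (by lia) h₁, hC.inj j hj l hl h₂⟩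
  · have := hC.inj i (by lia) l hl h₁
    have := hC.inj j hj k (by lia) h₂
    lia

variable [Fintype V]

/-- The cycle inequality defines a facet if and only if the cycle has no chord. -/
theorem definesFacet_iff (hC : IsIndexedCycle G P n) (hle : G ≤ H) (hG : G.Connected) :
    DefinesFacet H (LMC G H) (fun x => cycleSlack P n x) 0 ↔
      ∀ i j, i < j → j ≤ n → H.Adj (P i) (P j) → j = i + 1 ∨ i = 0 ∧ j = n := by
  have h2 := hC.two_le
  have hCH := hC.mono hle
  set E : Finset (Sym2 V) := H.edgeFinset with hE
  have hcard : Nat.card H.edgeSet = E.card := by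
    rw [Nat.card_eq_fintype_card, SimpleGraph.card_edgeSet]
  have hfE : s(P 0, P n) ∈ E := by simpa [hE] using hCH.adj_close
  have hoff : ∀ {x e}, x ∈ faceDirection G H P n → e ∉ E → x e = 0 := fun hx he =>
    apply_eq_zero_of_mem_faceDirection (fun h => he (by simpa [hE] using h)) hx
  have hvalid : ∀ x ∈ LMC G H, cycleSlack P n x ≤ 0 := fun x hx => hCH.cycleSlack_le_zero hx
  change (_ ∧ Module.finrank ℝ (faceDirection G H P n) + 1 = _) ↔ _
  rw [hcard]
  constructor
  · rintro ⟨-, hrank⟩ i j hij hj hadj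
    by_contra hchord
    have hgE : s(P i, P j) ∈ E.erase s(P 0, P n) := by
      rw [Finset.mem_erase]
      refine ⟨fun h => ?_, by simpa [hE] using hadj⟩
      have := hC.eq_of_edge_eq hij hj (by lia) le_rfl h
      lia
    have hle' : Module.finrank ℝ (faceDirection G H P n)
        ≤ ((E.erase s(P 0, P n)).erase s(P i, P j)).card := by
      refine finrank_le_card_of_forall_eq_zero _ _ fun x hx hT => ?_
      have hedge : ∀ k < n, x s(P k, P (k + 1)) = 0 := by
        intro k hk
        refine hT _ ?_
        rw [Finset.mem_erase, Finset.mem_erase]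
        refine ⟨fun h => ?_, fun h => ?_, by simpa [hE] using hCH.adj k hk⟩
        · have := hC.eq_of_edge_eq (by lia) (by lia) hij hj h
          lia
        · have := hC.eq_of_edge_eq (by lia) (by lia) (by lia) le_rfl h
          lia
      have hf : x s(P 0, P n) = 0 := by
        rw [eq_sum_of_mem_faceDirection hx]
        exact Finset.sum_eq_zero fun k hk => hedge k (Finset.mem_range.mp hk)
      have hg : x s(P i, P j) = 0 := by
        have h := faceDirection_le_ker (pathSlack P i j) (fun y hy h => le_antisymm
          (hCH.pathSlack_le_zero hij.le hj hadj hy)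
          (h ▸ hCH.cycleSlack_le_pathSlack hij.le hj hadj hy)) hx
        rw [pathSlack_apply, sub_eq_zero] at h
        rw [h]
        refine Finset.sum_eq_zero fun k hk => hedge k ?_
        rw [Finset.mem_Ico] at hk
        lia
      funext e
      by_cases heg : e = s(P i, P j)
      · rw [heg, hg, Pi.zero_apply]
      · by_cases hef : e = s(P 0, P n)
        · rw [hef, hf, Pi.zero_apply]
        · by_cases heE : e ∈ E
          · exact hT e (by simp [heg, hef, heE])
          · exact hoff hx heE
    have h₁ := Finset.card_erase_add_one hgE
    have h₂ := Finset.card_erase_add_one hfE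
    lia
  · intro hchord
    refine ⟨hvalid, ?_⟩
    have hupper : Module.finrank ℝ (faceDirection G H P n) ≤ (E.erase s(P 0, P n)).card := by
      refine finrank_le_card_of_forall_eq_zero _ _ fun x hx hT => ?_
      have hf : x s(P 0, P n) = 0 := by
        rw [eq_sum_of_mem_faceDirection hx]
        refine Finset.sum_eq_zero fun k hk => hT _ ?_
        rw [Finset.mem_range] at hk
        rw [Finset.mem_erase]
        refine ⟨fun h => ?_, by simpa [hE] using hCH.adj k hk⟩
        have := hC.eq_of_edge_eq (by lia) (by lia) (by lia) le_rfl h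
        lia
      funext e
      by_cases hef : e = s(P 0, P n)
      · rw [hef, hf, Pi.zero_apply]
      · by_cases heE : e ∈ E
        · exact hT e (by simp [hef, heE])
        · exact hoff hx heE
    have hlower : (E.erase s(P 0, P n)).card ≤ Module.finrank ℝ (faceDirection G H P n) := by
      refine card_le_finrank_of_forall_eq_zero _ _ fun a hoffT horth => ?_
      refine hC.weight_eq_zero hle hG ⟨fun e he => hoffT e ?_, hoffT _ (by simp), ?_⟩ hchord
      · simp [hE, he]
      · intro D hD h
        exact horth _ (hC.multicutVec_mem_faceDirection hle hG hD h)
    have := Finset.card_erase_add_one hfE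
    lia

end IsIndexedCycle

/-! ### Indexing the nodes of a cycle -/

theorem exists_eq_append_cons_of_mem_darts {G : SimpleGraph V} {u v : V} (p : G.Walk u v)
    {d : G.Dart} (hd : d ∈ p.darts) :
    ∃ (q : G.Walk u d.fst) (r : G.Walk d.snd v), p = q.append (.cons d.adj r) := by
  induction p with
  | nil => simp at hd
  | @cons u z v h p ih =>
    rw [SimpleGraph.Walk.darts_cons, List.mem_cons] at hd
    rcases hd with rfl | hd
    · exact ⟨.nil, p, rfl⟩
    · obtain ⟨q, r, rfl⟩ := ih hd
      exact ⟨.cons h q, r, rfl⟩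

/-- Removing an edge from a cycle leaves a path. -/
theorem exists_path_of_mem_edges_of_isCycle {G : SimpleGraph V} {w : V} {c : G.Walk w w}
    (hc : c.IsCycle) {f : Sym2 V} (hf : f ∈ c.edges) :
    ∃ (u v : V) (p : G.Walk u v), p.IsPath ∧ G.Adj u v ∧ f = s(u, v) ∧ f ∉ p.edges ∧
      (∀ e, e ∈ c.edges ↔ e = f ∨ e ∈ p.edges) ∧ ∀ t, t ∈ c.support ↔ t ∈ p.support := by
  obtain ⟨d, hd, rfl⟩ := List.mem_map.mp hf
  obtain ⟨q, r, rfl⟩ := exists_eq_append_cons_of_mem_darts c hd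
  refine ⟨d.snd, d.fst, r.append q, ?_, d.adj.symm, ?_, ?_, ?_, ?_⟩
  · rw [SimpleGraph.Walk.isPath_def]
    have h := hc.support_nodup
    rw [SimpleGraph.Walk.tail_support_append, SimpleGraph.Walk.support_cons,
      List.tail_cons] at h
    rw [SimpleGraph.Walk.support_append]
    exact (List.perm_append_comm.nodup_iff).mp h
  · rw [Sym2.eq_swap]
    rfl
  · have h := hc.edges_nodup
    rw [SimpleGraph.Walk.edges_append, SimpleGraph.Walk.edges_cons] at h
    have h' := (List.perm_middle.nodup_iff).mp h
    rw [List.nodup_cons] at h'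
    rw [SimpleGraph.Walk.edges_append]
    intro hmem
    exact h'.1 ((List.perm_append_comm.mem_iff).mp hmem)
  · intro e
    have : d.edge = s(d.fst, d.snd) := rfl
    simp only [SimpleGraph.Walk.edges_append, SimpleGraph.Walk.edges_cons, List.mem_append,
      List.mem_cons, this]
    tauto
  · intro t
    have h₁ : d.fst ∈ q.support := q.end_mem_support
    simp only [SimpleGraph.Walk.mem_support_append_iff, SimpleGraph.Walk.support_cons,
      List.mem_cons]
    constructor
    · rintro (h | rfl | h)
      exacts [Or.inr h, Or.inr h₁, Or.inl h]
    · rintro (h | h)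
      exacts [Or.inr (Or.inr h), Or.inl h]

/-- for a cycle `C` in `G` and `f` an edge of `C`, the cycle inequality
`x_f ≤ ∑_{e ∈ E_C \ {f}} x_e` defines a facet of `LMC(G, Gh)` iff `C` is chordless
in `Gh`. -/
theorem cycle_inequality_facet_iff_chordless
    {V : Type*} [Fintype V] (G Gh : SimpleGraph V)
    (hG : G.Connected) (hle : G ≤ Gh)
    {w : V} (c : G.Walk w w) (hc : c.IsCycle) (f : Sym2 V) (hf : f ∈ c.edges) :
    DefinesFacet Gh (LMC G Gh)
        (fun x => x f - ∑ e ∈ c.edges.toFinset.erase f, x e) 0 ↔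
      ∀ a b : V, a ∈ c.support → b ∈ c.support → Gh.Adj a b → s(a, b) ∈ c.edges := by
  obtain ⟨u, v, p, hp, huv, hfuv, hfp, hedges, hsupp⟩ := exists_path_of_mem_edges_of_isCycle hc hf
  have h0 : p.getVert 0 = u := p.getVert_zero
  have hn : p.getVert p.length = v := p.getVert_length
  have hmem : ∀ a b, s(a, b) ∈ p.edges ↔
      ∃ i < p.length, s(p.getVert i, p.getVert (i + 1)) = s(a, b) :=
    fun a b => p.mk_mem_edges_iff_exists
  have hf' : f = s(p.getVert 0, p.getVert p.length) := by rw [h0, hn, hfuv]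
  have hC : IsIndexedCycle G p.getVert p.length := by
    refine ⟨?_, fun i hi j hj h => hp.getVert_injOn hi hj h, fun i hi => p.adj_getVert_succ hi,
      by rwa [h0, hn]⟩
    by_contra hlt
    have hlen : p.length = 0 ∨ p.length = 1 := by lia
    rcases hlen with hl | hl
    · rw [hl, h0] at hn
      exact huv.ne hn
    · apply hfp
      rw [hfuv, hmem]
      exact ⟨0, by lia, by rw [← hl, h0, zero_add, hl, ← hl, hn]⟩
  have hset : c.edges.toFinset.erase f
      = (Finset.range p.length).image fun i => s(p.getVert i, p.getVert (i + 1)) := by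
    ext e
    rw [Finset.mem_erase, List.mem_toFinset, hedges, Finset.mem_image]
    induction e with
    | _ a b =>
      simp only [Finset.mem_range]
      rw [← hmem]
      constructor
      · rintro ⟨hne, h | h⟩
        exacts [absurd h hne, h]
      · intro h
        exact ⟨fun h' => hfp (h' ▸ h), Or.inr h⟩
  have hfun : (fun x : Sym2 V → ℝ => x f - ∑ e ∈ c.edges.toFinset.erase f, x e)
      = fun x => cycleSlack p.getVert p.length x := by
    funext x
    rw [hset, Finset.sum_image, cycleSlack_apply, hf']
    intro i hi j hj h
    simp only [Finset.coe_range, Set.mem_Iio] at hi hj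
    exact (hC.eq_of_edge_eq (by lia) (by lia) (by lia) (by lia) h).1
  rw [hfun, hC.definesFacet_iff hle hG]
  constructor
  · intro h a b ha hb hab
    have hsym : ∀ i j, i < j → j ≤ p.length → Gh.Adj (p.getVert i) (p.getVert j) →
        s(p.getVert i, p.getVert j) ∈ c.edges := by
      intro i j hij hj hadj
      rw [hedges]
      rcases h i j hij hj hadj with rfl | ⟨rfl, rfl⟩
      · exact Or.inr ((hmem _ _).mpr ⟨i, by lia, rfl⟩)
      · exact Or.inl hf'.symm
    rw [hsupp, SimpleGraph.Walk.mem_support_iff_exists_getVert] at ha hb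
    obtain ⟨i, rfl, hi⟩ := ha
    obtain ⟨j, rfl, hj⟩ := hb
    rcases lt_trichotomy i j with hij | rfl | hij
    · exact hsym i j hij hj hab
    · exact absurd rfl hab.ne
    · rw [Sym2.eq_swap]
      exact hsym j i hij hi hab.symm
  · intro h i j hij hj hadj
    have := h _ _ ((hsupp _).mpr (p.getVert_mem_support i))
      ((hsupp _).mpr (p.getVert_mem_support j)) hadj
    rw [hedges, hf', hmem] at this
    have h2 := hC.two_le
    rcases this with h' | ⟨k, hk, h'⟩
    · exact Or.inr (hC.eq_of_edge_eq hij hj (by lia) le_rfl h')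
    · have := hC.eq_of_edge_eq (by lia) (by lia) hij hj h'
      lia
end
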